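/- arXiv:2509.05990 — 9 statements merged into one kernel-verified Lean document; each statement's English description precedes it below -/
import Mathlib

section
/- Let A be a left Leibniz algebra over a field F. The following are equivalent: (i) A is perfect; (ii) for every left Leibniz algebra M over F, every subalgebra K of M that is an ideal of M, and every ideal J of K that is isomorphic to A as a Leibniz algebra, J is an ideal of M; (iii) for every left Leibniz algebra K over F and every ideal J of K that is isomorphic to A as a Leibniz algebra, J is a characteristic ideal of K. -/
/- A left Leibniz algebra over a field `F`. -/
universe u v

class LeibnizAlgebra (F : Type u) (A : Type v) [Field F] [AddCommGroup A] [Module F A]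
    extends Bracket A A where
  add_lie' : ∀ x y z : A, ⁅x + y, z⁆ = ⁅x, z⁆ + ⁅y, z⁆
  lie_add' : ∀ x y z : A, ⁅x, y + z⁆ = ⁅x, y⁆ + ⁅x, z⁆
  smul_lie' : ∀ (t : F) (x y : A), ⁅t • x, y⁆ = t • ⁅x, y⁆
  lie_smul' : ∀ (t : F) (x y : A), ⁅x, t • y⁆ = t • ⁅x, y⁆
  leibniz' : ∀ x y z : A, ⁅x, ⁅y, z⁆⁆ = ⁅⁅x, y⁆, z⁆ + ⁅y, ⁅x, z⁆⁆

section Defs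

variable (F : Type u) {A : Type v} [Field F] [AddCommGroup A] [Module F A] [LeibnizAlgebra F A]

/-- A derivation of a Leibniz algebra. -/
def IsLeibnizDeriv (f : A →ₗ[F] A) : Prop :=
  ∀ x y : A, f ⁅x, y⁆ = ⁅f x, y⁆ + ⁅x, f y⁆

/-- A subalgebra of a Leibniz algebra: a subspace closed under the bracket. -/
def IsLeibnizSubalg (S : Submodule F A) : Prop := ∀ x ∈ S, ∀ y ∈ S, ⁅x, y⁆ ∈ S

/-- A (two-sided) ideal of a Leibniz algebra. -/
def IsLeibnizIdeal (J : Submodule F A) : Prop :=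
  ∀ (x : A), ∀ y ∈ J, ⁅x, y⁆ ∈ J ∧ ⁅y, x⁆ ∈ J

/-- `J` is an ideal of the subalgebra `S`. -/
def IsLeibnizIdealIn (J S : Submodule F A) : Prop :=
  J ≤ S ∧ ∀ x ∈ S, ∀ y ∈ J, ⁅x, y⁆ ∈ J ∧ ⁅y, x⁆ ∈ J

/-- A Leibniz algebra is perfect if it coincides with its derived subalgebra. -/
def IsPerfectLeibniz (A : Type v) [AddCommGroup A] [Module F A] [LeibnizAlgebra F A] : Prop :=
  Submodule.span F {z : A | ∃ x y : A, z = ⁅x, y⁆} = ⊤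

/-- `J` is (the image of) an isomorphic copy of the Leibniz algebra `A` inside `K`. -/
def IsIsoCopy (A : Type v) [AddCommGroup A] [Module F A] [LeibnizAlgebra F A]
    {K : Type v} [AddCommGroup K] [Module F K] [LeibnizAlgebra F K]
    (J : Submodule F K) : Prop :=
  ∃ e : A →ₗ[F] K, Function.Injective e ∧ LinearMap.range e = J ∧
    ∀ x y : A, e ⁅x, y⁆ = ⁅e x, e y⁆

end Defs

section Auxiliary

variable {F : Type u} {A : Type v} [Field F] [AddCommGroup A] [Module F A] [LeibnizAlgebra F A]

/-- If `J` is a perfect ideal copy of `A`, a linear map satisfying the Leibniz rule on `J` and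
sending products of elements of `J` into `J` preserves `J`. -/
theorem IsPerfectLeibniz.map_mem_of_isIsoCopy (hA : IsPerfectLeibniz F A)
    {K : Type v} [AddCommGroup K] [Module F K] [LeibnizAlgebra F K] {J : Submodule F K}
    (hJ : IsIsoCopy F A J) (f : K →ₗ[F] K) (hf : ∀ a ∈ J, ∀ b ∈ J, f ⁅a, b⁆ ∈ J) :
    ∀ x ∈ J, f x ∈ J := by
  obtain ⟨e, -, rfl, he⟩ := hJ
  rintro _ ⟨a, rfl⟩
  have ha : a ∈ Submodule.span F {z : A | ∃ x y : A, z = ⁅x, y⁆} := by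
    rw [show Submodule.span F {z : A | ∃ x y : A, z = ⁅x, y⁆} = ⊤ from hA]
    exact Submodule.mem_top
  suffices Submodule.span F {z : A | ∃ x y : A, z = ⁅x, y⁆} ≤
      (LinearMap.range e).comap (f ∘ₗ e) from this ha
  rw [Submodule.span_le]
  rintro _ ⟨x, y, rfl⟩
  change f (e ⁅x, y⁆) ∈ LinearMap.range e
  rw [he]
  exact hf _ ⟨x, rfl⟩ _ ⟨y, rfl⟩

/-- Left multiplication as a linear map. -/
def LeibnizAlgebra.mulLeft (F : Type u) {A : Type v} [Field F] [AddCommGroup A] [Module F A]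
    [LeibnizAlgebra F A] (x : A) : A →ₗ[F] A where
  toFun y := ⁅x, y⁆
  map_add' := LeibnizAlgebra.lie_add' (F := F) x
  map_smul' t := LeibnizAlgebra.lie_smul' t x

/-- Right multiplication as a linear map. -/
def LeibnizAlgebra.mulRight (F : Type u) {A : Type v} [Field F] [AddCommGroup A] [Module F A]
    [LeibnizAlgebra F A] (x : A) : A →ₗ[F] A where
  toFun y := ⁅y, x⁆
  map_add' y z := LeibnizAlgebra.add_lie' (F := F) y z x
  map_smul' t y := LeibnizAlgebra.smul_lie' t y x

/-- The Leibniz algebra `A × B × V` with bracket `⁅(a, b, v), (a', b', v')⁆ = (⁅a, a'⁆, β v a', 0)`,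
where `β v` vanishes on products. -/
abbrev LeibnizAlgebra.extension {B V : Type v} [AddCommGroup B] [Module F B] [AddCommGroup V]
    [Module F V] (β : V →ₗ[F] A →ₗ[F] B) (hβ : ∀ (v) (x y : A), β v ⁅x, y⁆ = 0) :
    LeibnizAlgebra F (A × B × V) where
  bracket m n := (⁅m.1, n.1⁆, β m.2.2 n.1, 0)
  add_lie' x y z := by
    ext <;> simp
    exact LeibnizAlgebra.add_lie' (F := F) _ _ _
  lie_add' x y z := by
    ext <;> simp
    exact LeibnizAlgebra.lie_add' (F := F) _ _ _
  smul_lie' t x y := by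
    ext <;> simp
    exact LeibnizAlgebra.smul_lie' t _ _
  lie_smul' t x y := by
    ext <;> simp
    exact LeibnizAlgebra.lie_smul' t _ _
  leibniz' x y z := by
    refine Prod.ext ?_ (Prod.ext ?_ ?_)
    · exact LeibnizAlgebra.leibniz' (F := F) x.1 y.1 z.1
    · change β x.2.2 ⁅y.1, z.1⁆ = β 0 z.1 + β y.2.2 ⁅x.1, z.1⁆
      simp [hβ]
    · change (0 : V) = 0 + 0
      simp

/-- The first factor of `LeibnizAlgebra.extension` is a copy of `A`. -/
theorem LeibnizAlgebra.isIsoCopy_extension {B V : Type v} [AddCommGroup B] [Module F B]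
    [AddCommGroup V] [Module F V] (β : V →ₗ[F] A →ₗ[F] B) (hβ : ∀ (v) (x y : A), β v ⁅x, y⁆ = 0) :
    letI := LeibnizAlgebra.extension β hβ
    IsIsoCopy F A (LinearMap.range (LinearMap.inl F A (B × V))) := by
  refine ⟨LinearMap.inl F A (B × V), LinearMap.inl_injective, rfl, fun x y => ?_⟩
  change (⁅x, y⁆, (0 : B × V)) = (⁅x, y⁆, β 0 y, 0)
  rw [map_zero, LinearMap.zero_apply, Prod.mk_zero_zero]

/-- The quotient of `A` by its derived subspace is trivial only when `A` is perfect. -/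
theorem isPerfectLeibniz_of_mkQ_eq_zero
    (h : ∀ a : A, (Submodule.span F {z : A | ∃ x y : A, z = ⁅x, y⁆}).mkQ a = 0) :
    IsPerfectLeibniz F A :=
  (Submodule.eq_top_iff').2 fun a => (Submodule.Quotient.mk_eq_zero _).1 (h a)

/-- The quotient map by the derived subspace vanishes on products. -/
theorem mkQ_derived_lie (x y : A) :
    (Submodule.span F {z : A | ∃ x y : A, z = ⁅x, y⁆}).mkQ ⁅x, y⁆ = 0 :=
  (Submodule.Quotient.mk_eq_zero _).2 (Submodule.subset_span ⟨x, y, rfl⟩)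

theorem IsPerfectLeibniz.isLeibnizIdeal_of_isLeibnizIdealIn (hA : IsPerfectLeibniz F A)
    {M : Type v} [AddCommGroup M] [Module F M] [LeibnizAlgebra F M] {K J : Submodule F M}
    (hK : IsLeibnizIdeal F K) (hJK : IsLeibnizIdealIn F J K) (hJ : IsIsoCopy F A J) :
    IsLeibnizIdeal F J := by
  intro x y hy
  constructor
  · refine hA.map_mem_of_isIsoCopy hJ (LeibnizAlgebra.mulLeft F x) (fun a ha b hb => ?_) y hy
    change ⁅x, ⁅a, b⁆⁆ ∈ J
    rw [LeibnizAlgebra.leibniz' (F := F)]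
    exact J.add_mem (hJK.2 _ (hK x a (hJK.1 ha)).1 b hb).1 (hJK.2 _ (hK x b (hJK.1 hb)).1 a ha).2
  · refine hA.map_mem_of_isIsoCopy hJ (LeibnizAlgebra.mulRight F x) (fun a ha b hb => ?_) y hy
    change ⁅⁅a, b⁆, x⁆ ∈ J
    rw [eq_sub_of_add_eq (LeibnizAlgebra.leibniz' (F := F) a b x).symm]
    exact J.sub_mem (hJK.2 _ (hK x b (hJK.1 hb)).2 a ha).2 (hJK.2 _ (hK x a (hJK.1 ha)).2 b hb).2

theorem IsPerfectLeibniz.map_mem_of_isLeibnizDeriv (hA : IsPerfectLeibniz F A)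
    {K : Type v} [AddCommGroup K] [Module F K] [LeibnizAlgebra F K] {J : Submodule F K}
    (hJK : IsLeibnizIdeal F J) (hJ : IsIsoCopy F A J) {f : K →ₗ[F] K} (hf : IsLeibnizDeriv F f) :
    ∀ x ∈ J, f x ∈ J := by
  refine hA.map_mem_of_isIsoCopy hJ f fun a ha b hb => ?_
  rw [hf]
  exact J.add_mem (hJK _ b hb).1 (hJK _ a ha).2

theorem isPerfectLeibniz_of_forall_isLeibnizIdeal
    (h : ∀ (M : Type v) [AddCommGroup M] [Module F M] [LeibnizAlgebra F M] (K J : Submodule F M),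
      IsLeibnizSubalg F K → IsLeibnizIdeal F K → IsLeibnizIdealIn F J K →
      IsIsoCopy F A J → IsLeibnizIdeal F J) :
    IsPerfectLeibniz F A := by
  let D : Submodule F A := Submodule.span F {z : A | ∃ x y : A, z = ⁅x, y⁆}
  let β : Module.End F (A ⧸ D) →ₗ[F] A →ₗ[F] A ⧸ D := LinearMap.lcomp F (A ⧸ D) D.mkQ
  have hβ : ∀ (v) (x y : A), β v ⁅x, y⁆ = 0 := fun v x y => by
    change v (D.mkQ ⁅x, y⁆) = 0
    rw [mkQ_derived_lie, map_zero]
  let := LeibnizAlgebra.extension β hβ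
  let K : Submodule F (A × (A ⧸ D) × Module.End F (A ⧸ D)) :=
    LinearMap.ker (LinearMap.snd F _ _ ∘ₗ LinearMap.snd F _ _)
  have hJ := h _ K _ (fun _ _ _ _ => rfl) (fun _ _ _ => ⟨rfl, rfl⟩)
    ⟨by rintro _ ⟨a, rfl⟩; rfl, ?_⟩ (LeibnizAlgebra.isIsoCopy_extension β hβ)
  · refine isPerfectLeibniz_of_mkQ_eq_zero fun a => ?_
    obtain ⟨b, hb⟩ := (hJ (0, 0, LinearMap.id) _ ⟨a, rfl⟩).1
    exact (congrArg (fun m => m.2.1) hb).symm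
  · rintro ⟨a, b, v⟩ (rfl : v = 0) _ ⟨c, rfl⟩
    refine ⟨⟨⁅a, c⁆, ?_⟩, ⟨⁅c, a⁆, ?_⟩⟩
    · change (⁅a, c⁆, (0 : (A ⧸ D) × Module.End F (A ⧸ D))) = (⁅a, c⁆, β 0 c, 0)
      rw [map_zero, LinearMap.zero_apply, Prod.mk_zero_zero]
    · change (⁅c, a⁆, (0 : (A ⧸ D) × Module.End F (A ⧸ D))) = (⁅c, a⁆, β 0 a, 0)
      rw [map_zero, LinearMap.zero_apply, Prod.mk_zero_zero]

theorem isPerfectLeibniz_of_forall_map_mem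
    (h : ∀ (K : Type v) [AddCommGroup K] [Module F K] [LeibnizAlgebra F K] (J : Submodule F K),
      IsLeibnizIdeal F J → IsIsoCopy F A J →
      ∀ f : K →ₗ[F] K, IsLeibnizDeriv F f → ∀ x ∈ J, f x ∈ J) :
    IsPerfectLeibniz F A := by
  let D : Submodule F A := Submodule.span F {z : A | ∃ x y : A, z = ⁅x, y⁆}
  let β : PUnit.{v + 1} →ₗ[F] A →ₗ[F] A ⧸ D := 0
  have hβ : ∀ (v) (x y : A), β v ⁅x, y⁆ = 0 := fun _ _ _ => rfl
  let := LeibnizAlgebra.extension β hβ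
  let f : A × (A ⧸ D) × PUnit.{v + 1} →ₗ[F] A × (A ⧸ D) × PUnit.{v + 1} :=
    LinearMap.inr F A _ ∘ₗ LinearMap.inl F (A ⧸ D) PUnit.{v + 1} ∘ₗ D.mkQ ∘ₗ LinearMap.fst F A _
  have hf := h _ _ ?_ (LeibnizAlgebra.isIsoCopy_extension β hβ) f ?_
  · refine isPerfectLeibniz_of_mkQ_eq_zero fun a => ?_
    obtain ⟨b, hb⟩ := hf _ ⟨a, rfl⟩
    exact (congrArg (fun m => m.2.1) hb).symm
  · rintro ⟨a, b, v⟩ _ ⟨c, rfl⟩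
    exact ⟨⟨⁅a, c⁆, rfl⟩, ⟨⁅c, a⁆, rfl⟩⟩
  · intro x y
    refine Prod.ext ?_ (Prod.ext ?_ rfl)
    · change (0 : A) = ⁅(0 : A), y.1⁆ + ⁅x.1, (0 : A)⁆
      have h₁ : ⁅(0 : A), y.1⁆ = 0 := (LeibnizAlgebra.mulRight F y.1).map_zero
      have h₂ : ⁅x.1, (0 : A)⁆ = 0 := (LeibnizAlgebra.mulLeft F x.1).map_zero
      rw [h₁, h₂, add_zero]
    · change D.mkQ ⁅x.1, y.1⁆ = 0 + 0
      rw [mkQ_derived_lie, add_zero]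

end Auxiliary

theorem perfect_leibniz_tfae (F : Type u) (A : Type v) [Field F] [AddCommGroup A]
    [Module F A] [LeibnizAlgebra F A] :
    (IsPerfectLeibniz F A ↔
      ∀ (M : Type v) [AddCommGroup M] [Module F M] [LeibnizAlgebra F M]
        (K J : Submodule F M),
        IsLeibnizSubalg F K → IsLeibnizIdeal F K → IsLeibnizIdealIn F J K →
        IsIsoCopy F A J → IsLeibnizIdeal F J) ∧
    (IsPerfectLeibniz F A ↔
      ∀ (K : Type v) [AddCommGroup K] [Module F K] [LeibnizAlgebra F K]
        (J : Submodule F K),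
        IsLeibnizIdeal F J → IsIsoCopy F A J →
        ∀ f : K →ₗ[F] K, IsLeibnizDeriv F f → ∀ x ∈ J, f x ∈ J) :=
  ⟨⟨fun hA _ _ _ _ _ _ _ hK hJK hJ => hA.isLeibnizIdeal_of_isLeibnizIdealIn hK hJK hJ,
      isPerfectLeibniz_of_forall_isLeibnizIdeal⟩,
    ⟨fun hA _ _ _ _ _ hJK hJ _ hf => hA.map_mem_of_isLeibnizDeriv hJK hJ hf,
      isPerfectLeibniz_of_forall_map_mem⟩⟩
end

section
/- Let A be a perfect left Leibniz algebra over a field F. If A is an ideal of a left Leibniz algebra K and K is an ideal of a left Leibniz algebra M (with A a subalgebra of K and K a subalgebra of M), then A is an ideal of M. -/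
/- A left Leibniz algebra over a field `F`. -/
universe u v

section Defs

variable (F : Type u) {A : Type v} [Field F] [AddCommGroup A] [Module F A] [LeibnizAlgebra F A]

/-- A subspace is perfect if it is spanned by brackets of its own elements. -/
def IsPerfectCarrier (S : Submodule F A) : Prop :=
  Submodule.span F {z : A | ∃ x ∈ S, ∃ y ∈ S, z = ⁅x, y⁆} = S

end Defs

theorem perfect_subideal_is_ideal (F : Type u) (M : Type v) [Field F] [AddCommGroup M]
    [Module F M] [LeibnizAlgebra F M] (A K : Submodule F M)
    (hAsub : IsLeibnizSubalg F A) (hKsub : IsLeibnizSubalg F K)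
    (hAK : IsLeibnizIdealIn F A K) (hKM : IsLeibnizIdeal F K)
    (hperf : IsPerfectCarrier F A) :
    IsLeibnizIdeal F A := by
  intro m a ha
  rw [← hperf] at ha
  induction ha using Submodule.span_induction with
  | mem z hz =>
    obtain ⟨x, hx, y, hy, rfl⟩ := hz
    constructor
    · rw [LeibnizAlgebra.leibniz' (F := F) m x y]
      exact A.add_mem (hAK.2 _ (hKM m x (hAK.1 hx)).1 y hy).1
        (hAK.2 _ (hKM m y (hAK.1 hy)).1 x hx).2
    · rw [← sub_eq_iff_eq_add.mpr (LeibnizAlgebra.leibniz' (F := F) x y m)]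
      exact A.sub_mem (hAK.2 _ (hKM m y (hAK.1 hy)).2 x hx).2
        (hAK.2 _ (hKM m x (hAK.1 hx)).2 y hy).2
  | zero =>
    have h₁ := LeibnizAlgebra.lie_smul' (0 : F) m (0 : M)
    have h₂ := LeibnizAlgebra.smul_lie' (0 : F) (0 : M) m
    rw [zero_smul, zero_smul] at h₁ h₂
    rw [h₁, h₂]
    exact ⟨A.zero_mem, A.zero_mem⟩
  | add x y _ _ hx hy =>
    rw [LeibnizAlgebra.lie_add' (F := F), LeibnizAlgebra.add_lie' (F := F)]
    exact ⟨A.add_mem hx.1 hy.1, A.add_mem hx.2 hy.2⟩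
  | smul t x _ hx =>
    rw [LeibnizAlgebra.lie_smul', LeibnizAlgebra.smul_lie']
    exact ⟨A.smul_mem t hx.1, A.smul_mem t hx.2⟩
end

section
/- Let A be a left Leibniz algebra over a field F. Then the Lie-center Z_Lie(A) is a characteristic ideal of A: it is an ideal of A and f(Z_Lie(A)) ⊆ Z_Lie(A) for every derivation f of A. -/
universe u v w

section Defs

variable (F : Type u) {A : Type v} [Field F] [AddCommGroup A] [Module F A] [LeibnizAlgebra F A]

/-- The bracket of a Leibniz algebra, as a bilinear map. -/
def leibnizBracketHom : A →ₗ[F] A →ₗ[F] A :=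
  LinearMap.mk₂ F (fun x y => ⁅x, y⁆) LeibnizAlgebra.add_lie' LeibnizAlgebra.smul_lie'
    LeibnizAlgebra.lie_add' LeibnizAlgebra.lie_smul'

@[simp] lemma leibnizBracketHom_apply (x y : A) : leibnizBracketHom F x y = ⁅x, y⁆ := rfl

end Defs

section Lemmas
variable {F : Type u} {A : Type v} [Field F] [AddCommGroup A] [Module F A] [LeibnizAlgebra F A]

lemma zero_lie' (y : A) : ⁅(0 : A), y⁆ = 0 := by
  rw [← leibnizBracketHom_apply F]; exact LinearMap.map_zero₂ (leibnizBracketHom F) y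

lemma lie_zero' (x : A) : ⁅x, (0 : A)⁆ = 0 := by
  rw [← leibnizBracketHom_apply F]; exact (leibnizBracketHom F x).map_zero

lemma sub_lie' (x y z : A) : ⁅x - y, z⁆ = ⁅x, z⁆ - ⁅y, z⁆ := by
  simp only [← leibnizBracketHom_apply F]; exact LinearMap.map_sub₂ (leibnizBracketHom F) x y z

lemma lie_sub' (x y z : A) : ⁅x, y - z⁆ = ⁅x, y⁆ - ⁅x, z⁆ := by
  simp only [← leibnizBracketHom_apply F]; exact (leibnizBracketHom F x).map_sub y z

end Lemmas
section Center

variable (F : Type u) (A : Type v) [Field F] [AddCommGroup A] [Module F A] [LeibnizAlgebra F A]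

/-- The Lie-center `Z_Lie(A) = {x : [x,y] + [y,x] = 0 for all y}` of a Leibniz algebra. -/
def lieCenterLeibniz : Submodule F A where
  carrier := {x : A | ∀ y : A, ⁅x, y⁆ + ⁅y, x⁆ = 0}
  zero_mem' := by
    intro y
    have h1 : ⁅(0 : A), y⁆ = 0 := LinearMap.map_zero₂ (leibnizBracketHom F) y
    have h2 : ⁅y, (0 : A)⁆ = 0 := (leibnizBracketHom F y).map_zero
    rw [h1, h2, add_zero]
  add_mem' := by
    intro a b ha hb y
    have h1 : ⁅a + b, y⁆ = ⁅a, y⁆ + ⁅b, y⁆ := LeibnizAlgebra.add_lie' a b y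
    have h2 : ⁅y, a + b⁆ = ⁅y, a⁆ + ⁅y, b⁆ := LeibnizAlgebra.lie_add' y a b
    rw [h1, h2]
    have := ha y
    have := hb y
    abel_nf
    linear_combination (norm := abel) ha y + hb y
  smul_mem' := by
    intro t a ha y
    have h1 : ⁅t • a, y⁆ = t • ⁅a, y⁆ := LeibnizAlgebra.smul_lie' t a y
    have h2 : ⁅y, t • a⁆ = t • ⁅y, a⁆ := LeibnizAlgebra.lie_smul' t y a
    rw [h1, h2, ← smul_add, ha y, smul_zero]

/-- A Lie-derivation of a Leibniz algebra: a derivation whose image lies in the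
Lie-center. -/
def IsLieDerivOfLeibniz (f : A →ₗ[F] A) : Prop :=
  IsLeibnizDeriv F f ∧ ∀ x : A, f x ∈ lieCenterLeibniz F A

end Center

section CharacteristicIdeal

variable {F : Type u} {A : Type v} [Field F] [AddCommGroup A] [Module F A] [LeibnizAlgebra F A]

lemma mem_lieCenterLeibniz {x : A} :
    x ∈ lieCenterLeibniz F A ↔ ∀ y : A, ⁅x, y⁆ + ⁅y, x⁆ = 0 := Iff.rfl

/-- A derivation maps the Lie-center to itself. -/
lemma IsLeibnizDeriv.map_mem_lieCenterLeibniz {f : A →ₗ[F] A} (hf : IsLeibnizDeriv F f) {x : A}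
    (hx : x ∈ lieCenterLeibniz F A) : f x ∈ lieCenterLeibniz F A := by
  rw [mem_lieCenterLeibniz] at hx ⊢
  intro y
  have h := congrArg f (hx y)
  rw [map_add, hf, hf, map_zero] at h
  linear_combination (norm := abel) h - hx (f y)

/-- Left multiplications are derivations. -/
lemma isLeibnizDeriv_leibnizBracketHom (a : A) : IsLeibnizDeriv F (leibnizBracketHom F a) :=
  LeibnizAlgebra.leibniz' (F := F) a

end CharacteristicIdeal

theorem lieCenter_is_characteristic_ideal (F : Type u) (A : Type v) [Field F]
    [AddCommGroup A] [Module F A] [LeibnizAlgebra F A] :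
    IsLeibnizIdeal F (lieCenterLeibniz F A) ∧
      ∀ f : A →ₗ[F] A, IsLeibnizDeriv F f →
        ∀ x ∈ lieCenterLeibniz F A, f x ∈ lieCenterLeibniz F A := by
  refine ⟨fun a x hx => ?_, fun f hf x hx => hf.map_mem_lieCenterLeibniz hx⟩
  have h : ⁅a, x⁆ ∈ lieCenterLeibniz F A :=
    (isLeibnizDeriv_leibnizBracketHom a).map_mem_lieCenterLeibniz hx
  refine ⟨h, ?_⟩
  rw [eq_neg_of_add_eq_zero_left (hx a)]
  exact neg_mem h
end

section
/- Let A be a left Leibniz algebra over a field F. Then the space of Lie-derivations D_Lie(A) is an ideal of the Lie algebra D(A): if f ∈ D_Lie(A) and g ∈ D(A), then [f,g] = f∘g − g∘f ∈ D_Lie(A). -/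
universe u v w

section Helpers

variable {F : Type u} {A : Type v} [Field F] [AddCommGroup A] [Module F A] [LeibnizAlgebra F A]

/-- The commutator of two derivations is a derivation. -/
lemma IsLeibnizDeriv.commutator {f g : A →ₗ[F] A} (hf : IsLeibnizDeriv F f)
    (hg : IsLeibnizDeriv F g) : IsLeibnizDeriv F (f ∘ₗ g - g ∘ₗ f) := by
  intro x y
  simp only [LinearMap.sub_apply, LinearMap.comp_apply, hf _ _, hg _ _, map_add,
    sub_lie' (F := F), lie_sub' (F := F)]
  abel

/-- Derivations preserve the Lie-center. -/
lemma IsLeibnizDeriv.map_mem_lieCenter {g : A →ₗ[F] A} (hg : IsLeibnizDeriv F g) {x : A}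
    (hx : x ∈ lieCenterLeibniz F A) : g x ∈ lieCenterLeibniz F A := by
  intro y
  have h := congrArg g (hx y)
  rw [map_add, hg, hg, map_zero] at h
  linear_combination (norm := abel) h - hx (g y)

end Helpers

theorem lieDerivs_ideal_of_derivs (F : Type u) (A : Type v) [Field F]
    [AddCommGroup A] [Module F A] [LeibnizAlgebra F A]
    (f g : A →ₗ[F] A) (hf : IsLieDerivOfLeibniz F A f) (hg : IsLeibnizDeriv F g) :
    IsLieDerivOfLeibniz F A (f ∘ₗ g - g ∘ₗ f) := by
  exact ⟨hf.1.commutator hg, fun x =>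
    sub_mem (hf.2 (g x)) (hg.map_mem_lieCenter (hf.2 x))⟩
end

section
/- Let A be a left Leibniz algebra over a field F. Then the Lie-holomorph hol_Lie(A) = A × D_Lie(A), equipped with the bilinear product [(x,f),(y,g)] = ([x,y] + f(y) − g(x), [f,g]), is a left Leibniz algebra over F, i.e. this product satisfies the left Leibniz identity. -/
universe u v w

section Hol

variable (F : Type u) (A : Type v) [Field F] [AddCommGroup A] [Module F A] [LeibnizAlgebra F A]

lemma mem_lieCenterLeibniz_iff (x : A) :
    x ∈ lieCenterLeibniz F A ↔ ∀ y : A, ⁅x, y⁆ + ⁅y, x⁆ = 0 := Iff.rfl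

lemma comm_isLeibnizDeriv (f g : A →ₗ[F] A) (hf : IsLeibnizDeriv F f)
    (hg : IsLeibnizDeriv F g) : IsLeibnizDeriv F (f ∘ₗ g - g ∘ₗ f) := by
  intro x y
  simp only [LinearMap.sub_apply, LinearMap.comp_apply]
  rw [hg x y, hf x y, map_add, map_add, hf (g x) y, hf x (g y), hg (f x) y, hg x (f y),
    sub_lie' (F := F), lie_sub' (F := F)]
  abel

lemma comm_mem_lieCenter (f g : A →ₗ[F] A) (hf : IsLieDerivOfLeibniz F A f)
    (hg : IsLeibnizDeriv F g) :
    ∀ x : A, (f ∘ₗ g - g ∘ₗ f) x ∈ lieCenterLeibniz F A := by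
  intro x
  rw [mem_lieCenterLeibniz_iff]
  intro y
  simp only [LinearMap.sub_apply, LinearMap.comp_apply]
  have h1 : ⁅f (g x), y⁆ + ⁅y, f (g x)⁆ = 0 :=
    (mem_lieCenterLeibniz_iff F A _).mp (hf.2 (g x)) y
  have h2 : g ⁅f x, y⁆ + g ⁅y, f x⁆ = 0 := by
    rw [← map_add g, (mem_lieCenterLeibniz_iff F A _).mp (hf.2 x) y, map_zero]
  have h3 : g ⁅f x, y⁆ = ⁅g (f x), y⁆ + ⁅f x, g y⁆ := hg _ _
  have h4 : g ⁅y, f x⁆ = ⁅g y, f x⁆ + ⁅y, g (f x)⁆ := hg _ _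
  have h5 : ⁅f x, g y⁆ + ⁅g y, f x⁆ = 0 :=
    (mem_lieCenterLeibniz_iff F A _).mp (hf.2 x) (g y)
  have h6 : ⁅g (f x), y⁆ + ⁅y, g (f x)⁆ = 0 := by
    linear_combination (norm := abel) h2 - h3 - h4 - h5
  rw [sub_lie' (F := F), lie_sub' (F := F)]
  linear_combination (norm := abel) h1 - h6

/-- The space of Lie-derivations `D_Lie(A)` as a subspace of the endomorphisms of `A`. -/
def lieDerivsLeibniz : Submodule F (A →ₗ[F] A) where
  carrier := {f : A →ₗ[F] A | IsLieDerivOfLeibniz F A f}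
  zero_mem' := by
    refine ⟨fun x y => ?_, fun x => ?_⟩
    · simp only [LinearMap.zero_apply]
      rw [zero_lie' (F := F), lie_zero' (F := F), add_zero]
    · simp only [LinearMap.zero_apply]
      exact (lieCenterLeibniz F A).zero_mem
  add_mem' := by
    rintro f g ⟨hfd, hfc⟩ ⟨hgd, hgc⟩
    refine ⟨fun x y => ?_, fun x => ?_⟩
    · simp only [LinearMap.add_apply]
      rw [hfd x y, hgd x y, LeibnizAlgebra.add_lie' (f x) (g x) y,
        LeibnizAlgebra.lie_add' x (f y) (g y)]
      abel
    · simp only [LinearMap.add_apply]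
      exact (lieCenterLeibniz F A).add_mem (hfc x) (hgc x)
  smul_mem' := by
    rintro t f ⟨hfd, hfc⟩
    refine ⟨fun x y => ?_, fun x => ?_⟩
    · simp only [LinearMap.smul_apply]
      rw [hfd x y, LeibnizAlgebra.smul_lie' t (f x) y, LeibnizAlgebra.lie_smul' t x (f y),
        smul_add]
    · simp only [LinearMap.smul_apply]
      exact (lieCenterLeibniz F A).smul_mem t (hfc x)

lemma comm_mem_lieDerivsLeibniz (f g : A →ₗ[F] A) (hf : f ∈ lieDerivsLeibniz F A)
    (hg : g ∈ lieDerivsLeibniz F A) : f ∘ₗ g - g ∘ₗ f ∈ lieDerivsLeibniz F A :=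
  ⟨comm_isLeibnizDeriv F A f g hf.1 hg.1, comm_mem_lieCenter F A f g hf hg.1⟩

/-- The bracket of the Lie-holomorph `hol_Lie(A) = A × D_Lie(A)`:
`[(x,f),(y,g)] = ([x,y] + f(y) - g(x), [f,g])`. -/
def holLieBracket (p q : A × ↥(lieDerivsLeibniz F A)) : A × ↥(lieDerivsLeibniz F A) :=
  (⁅p.1, q.1⁆ + (p.2 : A →ₗ[F] A) q.1 - (q.2 : A →ₗ[F] A) p.1,
   ⟨(p.2 : A →ₗ[F] A) ∘ₗ (q.2 : A →ₗ[F] A) - (q.2 : A →ₗ[F] A) ∘ₗ (p.2 : A →ₗ[F] A),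
    comm_mem_lieDerivsLeibniz F A _ _ p.2.2 q.2.2⟩)

end Hol

/-- The Lie-holomorph `hol_Lie(A) = A × D_Lie(A)` with the product
`[(x,f),(y,g)] = ([x,y] + f(y) - g(x), [f,g])` is a left Leibniz algebra over `F`:
the product is bilinear and satisfies the left Leibniz identity. -/
theorem holLie_is_leibnizAlgebra (F : Type u) (A : Type v) [Field F] [AddCommGroup A]
    [Module F A] [LeibnizAlgebra F A] :
    (∀ p q r : A × ↥(lieDerivsLeibniz F A),
      holLieBracket F A p (holLieBracket F A q r) =
        holLieBracket F A (holLieBracket F A p q) r +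
          holLieBracket F A q (holLieBracket F A p r)) ∧
    (∀ p p' q : A × ↥(lieDerivsLeibniz F A),
      holLieBracket F A (p + p') q = holLieBracket F A p q + holLieBracket F A p' q) ∧
    (∀ p q q' : A × ↥(lieDerivsLeibniz F A),
      holLieBracket F A p (q + q') = holLieBracket F A p q + holLieBracket F A p q') ∧
    (∀ (t : F) (p q : A × ↥(lieDerivsLeibniz F A)),
      holLieBracket F A (t • p) q = t • holLieBracket F A p q) ∧
    (∀ (t : F) (p q : A × ↥(lieDerivsLeibniz F A)),
      holLieBracket F A p (t • q) = t • holLieBracket F A p q) := by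
  refine ⟨?_, ?_, ?_, ?_, ?_⟩
  · rintro ⟨x, f, hf⟩ ⟨y, g, hg⟩ ⟨z, h, hh⟩
    refine Prod.ext ?_ (Subtype.ext (LinearMap.ext fun a => ?_))
    · have hfyz : f ⁅y, z⁆ = ⁅f y, z⁆ + ⁅y, f z⁆ := hf.1 y z
      have hgxz : g ⁅x, z⁆ = ⁅g x, z⁆ + ⁅x, g z⁆ := hg.1 x z
      have hhxy : h ⁅x, y⁆ = ⁅h x, y⁆ + ⁅x, h y⁆ := hh.1 x y
      have hcenter : ⁅h x, y⁆ + ⁅y, h x⁆ = 0 := hh.2 x y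
      have hxyz := LeibnizAlgebra.leibniz' (F := F) x y z
      simp only [holLieBracket, Prod.fst_add, LinearMap.sub_apply, LinearMap.comp_apply,
        map_add, map_sub, sub_lie' (F := F), lie_sub' (F := F),
        LeibnizAlgebra.add_lie' (F := F), LeibnizAlgebra.lie_add' (F := F)]
      linear_combination (norm := abel) hxyz + hfyz - hgxz + hhxy + hcenter
    · simp only [holLieBracket, Prod.snd_add, Submodule.coe_add, LinearMap.add_apply,
        LinearMap.sub_apply, LinearMap.comp_apply, map_sub]
      abel
  · rintro ⟨x, f, hf⟩ ⟨x', f', hf'⟩ ⟨y, g, hg⟩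
    refine Prod.ext ?_ (Subtype.ext (LinearMap.ext fun a => ?_))
    · simp only [holLieBracket, Prod.fst_add, Prod.snd_add, Submodule.coe_add,
        LinearMap.add_apply, map_add, LeibnizAlgebra.add_lie' (F := F)]
      abel
    · simp only [holLieBracket, Prod.snd_add, Submodule.coe_add, LinearMap.add_apply,
        LinearMap.sub_apply, LinearMap.comp_apply, map_add]
      abel
  · rintro ⟨x, f, hf⟩ ⟨y, g, hg⟩ ⟨y', g', hg'⟩
    refine Prod.ext ?_ (Subtype.ext (LinearMap.ext fun a => ?_))
    · simp only [holLieBracket, Prod.fst_add, Prod.snd_add, Submodule.coe_add,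
        LinearMap.add_apply, map_add, LeibnizAlgebra.lie_add' (F := F)]
      abel
    · simp only [holLieBracket, Prod.snd_add, Submodule.coe_add, LinearMap.add_apply,
        LinearMap.sub_apply, LinearMap.comp_apply, map_add]
      abel
  · rintro t ⟨x, f, hf⟩ ⟨y, g, hg⟩
    refine Prod.ext ?_ (Subtype.ext (LinearMap.ext fun a => ?_))
    · simp only [holLieBracket, Prod.smul_fst, Prod.smul_snd, Submodule.coe_smul,
        LinearMap.smul_apply, map_smul, LeibnizAlgebra.smul_lie', smul_add, smul_sub]
    · simp only [holLieBracket, Prod.smul_snd, Submodule.coe_smul, LinearMap.smul_apply,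
        LinearMap.sub_apply, LinearMap.comp_apply, map_smul, smul_sub]
  · rintro t ⟨x, f, hf⟩ ⟨y, g, hg⟩
    refine Prod.ext ?_ (Subtype.ext (LinearMap.ext fun a => ?_))
    · simp only [holLieBracket, Prod.smul_fst, Prod.smul_snd, Submodule.coe_smul,
        LinearMap.smul_apply, map_smul, LeibnizAlgebra.lie_smul', smul_add, smul_sub]
    · simp only [holLieBracket, Prod.smul_snd, Submodule.coe_smul, LinearMap.smul_apply,
        LinearMap.sub_apply, LinearMap.comp_apply, map_smul, smul_sub]
end

section
/- Let A be a left Leibniz algebra over a field F. Then the map x ↦ (x,0) is an injective Leibniz algebra homomorphism from A into the Lie-holomorph hol_Lie(A), and its image A × {0} is an ideal of hol_Lie(A). -/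
universe u v w

/-- The map `x ↦ (x, 0)` is an injective Leibniz algebra homomorphism from `A` into the
Lie-holomorph `hol_Lie(A)`, and its image `A × {0}` is an ideal of `hol_Lie(A)`. -/
theorem embed_ideal_into_holLie (F : Type u) (A : Type v) [Field F] [AddCommGroup A]
    [Module F A] [LeibnizAlgebra F A] :
    Function.Injective ⇑(LinearMap.inl F A ↥(lieDerivsLeibniz F A)) ∧
    (∀ x y : A,
      holLieBracket F A (LinearMap.inl F A ↥(lieDerivsLeibniz F A) x)
          (LinearMap.inl F A ↥(lieDerivsLeibniz F A) y) =
        LinearMap.inl F A ↥(lieDerivsLeibniz F A) ⁅x, y⁆) ∧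
    (∀ p ∈ Set.range ⇑(LinearMap.inl F A ↥(lieDerivsLeibniz F A)),
      ∀ q : A × ↥(lieDerivsLeibniz F A),
        holLieBracket F A q p ∈ Set.range ⇑(LinearMap.inl F A ↥(lieDerivsLeibniz F A)) ∧
        holLieBracket F A p q ∈ Set.range ⇑(LinearMap.inl F A ↥(lieDerivsLeibniz F A))) := by
  refine ⟨LinearMap.inl_injective, fun x y => ?_, ?_⟩
  · ext <;> simp [holLieBracket]
  · rintro _ ⟨x, rfl⟩ q
    exact ⟨⟨(holLieBracket F A q (LinearMap.inl F A _ x)).1, by ext <;> simp [holLieBracket]⟩,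
      ⟨(holLieBracket F A (LinearMap.inl F A _ x) q).1, by ext <;> simp [holLieBracket]⟩⟩
end

section
/- Let A be a perfect subalgebra of a left Leibniz algebra K over a field F. Then the normalizer N_K(A) is self-normalizing: N_K(N_K(A)) = N_K(A). -/
/- A left Leibniz algebra over a field `F`. -/
universe u v

/-- If the perfect subspace `A` is an ideal of `N`, and `N` is an ideal of `M`, then `A` is an
ideal of `M`. -/
theorem IsLeibnizIdealIn.trans_of_isPerfectCarrier {F : Type u} {K : Type v} [Field F]
    [AddCommGroup K] [Module F K] [LeibnizAlgebra F K] {A N M : Submodule F K}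
    (hperf : IsPerfectCarrier F A) (hAN : IsLeibnizIdealIn F A N)
    (hNM : IsLeibnizIdealIn F N M) : IsLeibnizIdealIn F A M := by
  refine ⟨hAN.1.trans hNM.1, fun x hx y hy => ?_⟩
  rw [← hperf] at hy
  induction hy using Submodule.span_induction with
  | mem z hz =>
    obtain ⟨a, ha, b, hb, rfl⟩ := hz
    constructor
    · rw [LeibnizAlgebra.leibniz' (F := F)]
      exact A.add_mem (hAN.2 _ (hNM.2 x hx a (hAN.1 ha)).1 b hb).1
        (hAN.2 _ (hNM.2 x hx b (hAN.1 hb)).1 a ha).2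
    · rw [← add_sub_cancel_right ⁅⁅a, b⁆, x⁆ ⁅b, ⁅a, x⁆⁆, ← LeibnizAlgebra.leibniz' (F := F)]
      exact A.sub_mem (hAN.2 _ (hNM.2 x hx b (hAN.1 hb)).2 a ha).2
        (hAN.2 _ (hNM.2 x hx a (hAN.1 ha)).2 b hb).2
  | zero =>
    have h₁ : ⁅x, (0 : K)⁆ = 0 := by
      simpa using LeibnizAlgebra.lie_smul' (0 : F) x (0 : K)
    have h₂ : ⁅(0 : K), x⁆ = 0 := by
      simpa using LeibnizAlgebra.smul_lie' (0 : F) (0 : K) x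
    simp [h₁, h₂]
  | add y z _ _ hy hz =>
    rw [LeibnizAlgebra.lie_add' (F := F), LeibnizAlgebra.add_lie' (F := F)]
    exact ⟨A.add_mem hy.1 hz.1, A.add_mem hy.2 hz.2⟩
  | smul t y _ hy =>
    rw [LeibnizAlgebra.lie_smul', LeibnizAlgebra.smul_lie']
    exact ⟨A.smul_mem t hy.1, A.smul_mem t hy.2⟩

/-- For a perfect Leibniz subalgebra `A` of `K`, the normalizer `N_K(A)` (the largest
subalgebra of `K` containing `A` as an ideal) is self-normalizing. -/
theorem normalizer_of_perfect_selfNormalizing (F : Type u) (K : Type v) [Field F]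
    [AddCommGroup K] [Module F K] [LeibnizAlgebra F K] (A N NN : Submodule F K)
    (hA : IsLeibnizSubalg F A) (hperf : IsPerfectCarrier F A)
    (hN : IsGreatest {S : Submodule F K | IsLeibnizSubalg F S ∧ IsLeibnizIdealIn F A S} N)
    (hNN : IsGreatest {S : Submodule F K | IsLeibnizSubalg F S ∧ IsLeibnizIdealIn F N S} NN) :
    NN = N := by
  exact le_antisymm
    (hN.2 ⟨hNN.1.1, IsLeibnizIdealIn.trans_of_isPerfectCarrier hperf hN.1.2 hNN.1.2⟩) hNN.1.2.1
end

section
/- Let K be a left Leibniz algebra over a field F and let A be a characteristic ideal of K (an ideal with f(A) ⊆ A for every derivation f of K) such that the left-centralizer C^l_K(A) = {0}. Then the restriction map f ↦ f|_A is an injective Lie algebra homomorphism from D(K) into D(A). -/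
/- A left Leibniz algebra over a field `F`. -/
universe u v

/-- The induced Leibniz algebra structure on a subspace `J` of `K` that absorbs
left multiplications (e.g. an ideal). -/
def subLeibnizAlgebra (F : Type u) {K : Type v} [Field F] [AddCommGroup K] [Module F K]
    [LeibnizAlgebra F K] (J : Submodule F K) (h : ∀ (x : K), ∀ y ∈ J, ⁅x, y⁆ ∈ J) :
    LeibnizAlgebra F ↥J where
  bracket x y := ⟨⁅(x : K), (y : K)⁆, h x y y.2⟩
  add_lie' x y z := Subtype.ext
    (show ⁅(x : K) + (y : K), (z : K)⁆ = ⁅(x : K), (z : K)⁆ + ⁅(y : K), (z : K)⁆ from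
      LeibnizAlgebra.add_lie' _ _ _)
  lie_add' x y z := Subtype.ext
    (show ⁅(x : K), (y : K) + (z : K)⁆ = ⁅(x : K), (y : K)⁆ + ⁅(x : K), (z : K)⁆ from
      LeibnizAlgebra.lie_add' _ _ _)
  smul_lie' t x y := Subtype.ext
    (show ⁅t • (x : K), (y : K)⁆ = t • ⁅(x : K), (y : K)⁆ from
      LeibnizAlgebra.smul_lie' _ _ _)
  lie_smul' t x y := Subtype.ext
    (show ⁅(x : K), t • (y : K)⁆ = t • ⁅(x : K), (y : K)⁆ from
      LeibnizAlgebra.lie_smul' _ _ _)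
  leibniz' x y z := Subtype.ext
    (show ⁅(x : K), ⁅(y : K), (z : K)⁆⁆ =
        ⁅⁅(x : K), (y : K)⁆, (z : K)⁆ + ⁅(y : K), ⁅(x : K), (z : K)⁆⁆ from
      LeibnizAlgebra.leibniz' _ _ _)

/-- The left-slot bracket is compatible with subtraction. -/
theorem LeibnizAlgebra.sub_lie' (F : Type u) {K : Type v} [Field F] [AddCommGroup K] [Module F K]
    [LeibnizAlgebra F K] (x y z : K) : ⁅x - y, z⁆ = ⁅x, z⁆ - ⁅y, z⁆ := by
  rw [eq_sub_iff_add_eq, ← LeibnizAlgebra.add_lie' (F := F), sub_add_cancel]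

/-- Two derivations that agree on a left-absorbing subspace with trivial left-centralizer
are equal. -/
theorem IsLeibnizDeriv.eq_of_eqOn {F : Type u} {K : Type v} [Field F] [AddCommGroup K]
    [Module F K] [LeibnizAlgebra F K] {A : Submodule F K}
    (hA : ∀ (x : K), ∀ y ∈ A, ⁅x, y⁆ ∈ A)
    (hcent : ∀ x : K, (∀ y ∈ A, ⁅x, y⁆ = 0) → x = 0) {f g : K →ₗ[F] K}
    (hf : IsLeibnizDeriv F f) (hg : IsLeibnizDeriv F g) (hfg : ∀ y ∈ A, f y = g y) :
    f = g := by
  ext x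
  refine sub_eq_zero.mp (hcent _ fun y hy => ?_)
  have h := hfg _ (hA x y hy)
  rw [hf, hg, hfg y hy, add_left_inj] at h
  rw [LeibnizAlgebra.sub_lie' F, h, sub_self]

/-- If `A` is a characteristic ideal of `K` with trivial left-centralizer, then
restriction `f ↦ f|_A` is an injective Lie algebra homomorphism `D(K) → D(A)`. -/
theorem restriction_embeds_derivation_algebra (F : Type u) (K : Type v) [Field F]
    [AddCommGroup K] [Module F K] [LeibnizAlgebra F K] (A : Submodule F K)
    (hA : IsLeibnizIdeal F A)
    (hchar : ∀ f : K →ₗ[F] K, IsLeibnizDeriv F f → ∀ x ∈ A, f x ∈ A)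
    (hcent : ∀ x : K, (∀ y ∈ A, ⁅x, y⁆ = 0) → x = 0) :
    (∀ (f : K →ₗ[F] K) (hf : IsLeibnizDeriv F f),
      @IsLeibnizDeriv F ↥A _ _ _ (subLeibnizAlgebra F A fun x y hy => (hA x y hy).1)
        (f.restrict (hchar f hf))) ∧
    (∀ (f g : K →ₗ[F] K) (hf : IsLeibnizDeriv F f) (hg : IsLeibnizDeriv F g),
      f.restrict (hchar f hf) = g.restrict (hchar g hg) → f = g) ∧
    (∀ (f g : K →ₗ[F] K) (hf : IsLeibnizDeriv F f) (hg : IsLeibnizDeriv F g)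
      (hfg : IsLeibnizDeriv F (f ∘ₗ g - g ∘ₗ f)),
      (f ∘ₗ g - g ∘ₗ f).restrict (hchar _ hfg) =
        (f.restrict (hchar f hf)) ∘ₗ (g.restrict (hchar g hg)) -
          (g.restrict (hchar g hg)) ∘ₗ (f.restrict (hchar f hf))) := by
  refine ⟨fun f hf x y => Subtype.ext (hf x y), fun f g hf hg h => ?_,
    fun f g hf hg hfg => rfl⟩
  exact hf.eq_of_eqOn (fun x y hy => (hA x y hy).1) hcent hg fun y hy =>
    congrArg Subtype.val (LinearMap.congr_fun h ⟨y, hy⟩)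
end

section
/- Let g be a perfect Lie algebra over a field F with trivial center. Then the Lie algebra Der(g) of derivations of g is complete: its center is trivial and every derivation of Der(g) is inner, i.e. the adjoint map ad : Der(g) → Der(Der(g)) is bijective. -/
universe u v

namespace LieDerivation

variable {R L : Type*} [CommRing R] [LieRing L] [LieAlgebra R L]

/-- A derivation commuting with all inner derivations vanishes when `ad` is injective. -/
lemma eq_zero_of_lie_ad_eq_zero (hinj : Function.Injective (ad R L)) {D : LieDerivation R L L}
    (hD : ∀ x, ⁅D, ad R L x⁆ = 0) : D = 0 := by
  ext x
  apply hinj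
  rw [← lie_der_ad_eq_ad_der, hD, zero_apply, map_zero]

/-- A derivation of `Der L` vanishing on all inner derivations of `L` is zero when `ad` is
injective. -/
lemma eq_zero_of_apply_ad_eq_zero (hinj : Function.Injective (ad R L))
    {Φ : LieDerivation R (LieDerivation R L L) (LieDerivation R L L)}
    (hΦ : ∀ x, Φ (ad R L x) = 0) : Φ = 0 := by
  apply LieDerivation.ext
  intro D
  refine eq_zero_of_lie_ad_eq_zero hinj fun x ↦ ?_
  have h := Φ.apply_lie_eq_add D (ad R L x)
  rw [lie_der_ad_eq_ad_der, hΦ, hΦ, lie_zero, zero_add] at h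
  exact h.symm

/-- If `L` is perfect, derivations of `Der L` preserve the inner derivations of `L`. -/
lemma exists_ad_eq_apply_ad
    (hperf : Submodule.span R {z : L | ∃ x y : L, z = ⁅x, y⁆} = ⊤)
    (Φ : LieDerivation R (LieDerivation R L L) (LieDerivation R L L)) (z : L) :
    ∃ w, ad R L w = Φ (ad R L z) := by
  have hz : z ∈ Submodule.span R {z : L | ∃ x y : L, z = ⁅x, y⁆} := hperf ▸ Submodule.mem_top
  induction hz using Submodule.span_induction with
  | mem z hz =>
    obtain ⟨x, y, rfl⟩ := hz
    refine ⟨Φ (ad R L x) y - Φ (ad R L y) x, ?_⟩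
    rw [map_sub, ← lie_der_ad_eq_ad_der, ← lie_der_ad_eq_ad_der, LieHom.map_lie,
      apply_lie_eq_add, ← lie_skew (ad R L x), sub_eq_neg_add]
  | zero => exact ⟨0, by simp only [map_zero]⟩
  | add x y _ _ hx hy =>
    obtain ⟨u, hu⟩ := hx
    obtain ⟨v, hv⟩ := hy
    exact ⟨u + v, by simp only [map_add, hu, hv]⟩
  | smul a x _ hx =>
    obtain ⟨u, hu⟩ := hx
    exact ⟨a • u, by simp only [map_smul, hu]⟩

/-- A derivation of `Der L` preserving the inner derivations of `L` acts on them through a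
derivation of `L` when `ad` is injective. -/
lemma exists_ad_apply_eq_apply_ad (hinj : Function.Injective (ad R L))
    {Φ : LieDerivation R (LieDerivation R L L) (LieDerivation R L L)}
    (hΦ : ∀ z, ∃ w, ad R L w = Φ (ad R L z)) :
    ∃ d : LieDerivation R L L, ∀ z, ad R L (d z) = Φ (ad R L z) := by
  choose f hf using hΦ
  let d : L →ₗ[R] L :=
    { toFun := f
      map_add' := fun x y ↦ hinj <| by simp only [map_add, hf]
      map_smul' := fun a x ↦ hinj <| by simp only [map_smul, hf, RingHom.id_apply] }
  refine ⟨⟨d, fun x y ↦ hinj ?_⟩, hf⟩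
  change ad R L (f ⁅x, y⁆) = ad R L (⁅x, f y⁆ - ⁅y, f x⁆)
  rw [hf, LieHom.map_lie, apply_lie_eq_sub, map_sub, LieHom.map_lie, LieHom.map_lie, hf, hf]

/-- Every derivation of `Der L` is inner when `L` is perfect and `ad` is injective. -/
lemma ad_lieDerivation_surjective (hinj : Function.Injective (ad R L))
    (hperf : Submodule.span R {z : L | ∃ x y : L, z = ⁅x, y⁆} = ⊤) :
    Function.Surjective (ad R (LieDerivation R L L)) := by
  intro Φ
  obtain ⟨d, hd⟩ := exists_ad_apply_eq_apply_ad hinj (exists_ad_eq_apply_ad hperf Φ)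
  refine ⟨d, (sub_eq_zero.mp (eq_zero_of_apply_ad_eq_zero hinj fun x ↦ ?_)).symm⟩
  rw [sub_apply, ← hd, ← lie_der_ad_eq_ad_der, ad_apply_apply, sub_self]

end LieDerivation

/-- (Su–Zhu) If `g` is a perfect Lie algebra with trivial center, then the Lie algebra
`Der(g)` of derivations of `g` is complete: it has trivial center and every derivation of
`Der(g)` is inner, i.e. `ad : Der(g) → Der(Der(g))` is bijective. -/
theorem derivation_algebra_of_perfect_centerless_is_complete (F : Type u) (g : Type v)
    [Field F] [LieRing g] [LieAlgebra F g]
    (hperf : Submodule.span F {z : g | ∃ x y : g, z = ⁅x, y⁆} = ⊤)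
    (hcenter : ∀ x : g, (∀ y : g, ⁅x, y⁆ = 0) → x = 0) :
    (∀ D : LieDerivation F g g, (∀ E : LieDerivation F g g, ⁅D, E⁆ = 0) → D = 0) ∧
    Function.Bijective (LieDerivation.ad F (LieDerivation F g g)) := by
  have hinj : Function.Injective (LieDerivation.ad F g) :=
    (injective_iff_map_eq_zero _).mpr fun x hx ↦ hcenter x fun y ↦ by
      simpa using LieDerivation.congr_fun hx y
  have hcent : ∀ D : LieDerivation F g g, (∀ E : LieDerivation F g g, ⁅D, E⁆ = 0) → D = 0 :=
    fun D hD ↦ LieDerivation.eq_zero_of_lie_ad_eq_zero hinj fun x ↦ hD _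
  refine ⟨hcent, (injective_iff_map_eq_zero _).mpr fun D hD ↦ hcent D fun E ↦ ?_,
    LieDerivation.ad_lieDerivation_surjective hinj hperf⟩
  simpa using LieDerivation.congr_fun hD E
end
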